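/- Assume τ ≤ min{1/(63σu_-^2), 8/7785}, δ_R = δ_S^2, and δ_S ≤ δ_0 for δ_0 > 0 small enough. Define G^S(t) = Ẋ(t) ∫_ℝ φ^{-X} W(u^S) (u^S)' dξ + ∫_ℝ (r^{-X})^2 W(u^S) dξ - (3/4) ∫_ℝ (φ^{-X})^4 W'(u^S)(u^S)' dξ + ∫_ℝ (φ^{-X})^2 (u^S)' [σ W'(u^S) - 3(u^S)^2 W'(u^S) + 3u^S W(u^S) - (W''(u^S)/2)(u^S)'] dξ. Then for all t ∈ [0,T]: G^S(t) ≥ ∫_ℝ (r^{-X})^2 W(u^S) dξ - (5/6 + 9τσu_m^2/8) ∫_ℝ (∂_ξ φ^{-X})^2 W(u^S) dξ + (4/5) u_m^3 ∫_ℝ (φ^{-X})^2 (u^S)' dξ + (25/64) u_m^2 |Ẋ(t)|^2 + (3/4) ∫_ℝ (φ^{-X})^4 |W'(u^S)| (u^S)' dξ. -/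

import Mathlib

open Filter MeasureTheory

noncomputable section

/-- The weight function of the paper. -/
def W (um : ℝ) (s : ℝ) : ℝ :=
  if s < 0 then (5 / 2) * um * (um - s)
  else if s < um / 2 then (5 / (2 * um ^ 2)) * (um - s) * (4 * s ^ 3 + um ^ 3)
  else (15 / 8) * um ^ 2

/-- A degenerate viscous Oleinik shock profile for the cubic flux, connecting
`u₋ = -2 u_m` (at `-∞`) to `u_m` (at `+∞`), with speed `σ = 3 u_m²`. -/
def IsShockProfile (um τ : ℝ) (uS : ℝ → ℝ) : Prop :=
  ContDiff ℝ (⊤ : ℕ∞) uS ∧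
  (∀ ξ, -2 * um < uS ξ ∧ uS ξ < um) ∧
  (∀ ξ, deriv uS ξ =
      (uS ξ - (-2 * um)) * (uS ξ - um) ^ 2
        / (1 + 3 * τ * (3 * um ^ 2) * ((uS ξ) ^ 2 - um ^ 2))) ∧
  Tendsto uS atBot (nhds (-2 * um)) ∧
  Tendsto uS atTop (nhds um)

/-- The smooth solution of Burgers' equation with tanh initial data joining the
speeds `σ` and `λ₊`. -/
def BurgersSol (lamPlus σ : ℝ) (wR : ℝ → ℝ → ℝ) : Prop :=
  ContDiff ℝ (⊤ : ℕ∞) (fun p : ℝ × ℝ => wR p.1 p.2) ∧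
  (∀ t x : ℝ, 0 ≤ t →
    deriv (fun s => wR s x) t + wR t x * deriv (fun y => wR t y) x = 0) ∧
  (∀ x : ℝ, wR 0 x = (lamPlus + σ) / 2 + ((lamPlus - σ) / 2) * Real.tanh x)

/-- The shifted approximate rarefaction wave in the moving frame:
`ũ^R(t,ζ) = u^R(1+t, ζ + σt)`, where `u^R(t,x) = sqrt(w^R(t,x)/3)`. -/
def tuR (um : ℝ) (wR : ℝ → ℝ → ℝ) (t ζ : ℝ) : ℝ :=
  Real.sqrt (wR (1 + t) (ζ + 3 * um ^ 2 * t) / 3)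

/-- The heat-flux shock profile `q^S(ξ) = (u^S(ξ))³ - u₋³ - σ(u^S(ξ) - u₋)`. -/
def qS (um : ℝ) (uS : ℝ → ℝ) (ξ : ℝ) : ℝ :=
  (uS ξ) ^ 3 - (-2 * um) ^ 3 - 3 * um ^ 2 * (uS ξ - (-2 * um))

/-- The composite-wave ansatz `ũ(t,ζ) = u^S(ζ) + ũ^R(t,ζ) - u_m`. -/
def tu (um : ℝ) (uS : ℝ → ℝ) (wR : ℝ → ℝ → ℝ) (t ζ : ℝ) : ℝ :=
  uS ζ + tuR um wR t ζ - um

/-- The flux ansatz `q̃(t,ζ) = q^S(ζ) + ∂_ζ ũ^R(t,ζ)`. -/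
def tq (um : ℝ) (uS : ℝ → ℝ) (wR : ℝ → ℝ → ℝ) (t ζ : ℝ) : ℝ :=
  qS um uS ζ + deriv (tuR um wR t) ζ

/-- The error term `F(t,ζ) = ∂_ζ[ũ³ - (u^S)³ - (ũ^R)³] - ∂_ζ² ũ^R`. -/
def Ferr (um : ℝ) (uS : ℝ → ℝ) (wR : ℝ → ℝ → ℝ) (t ζ : ℝ) : ℝ :=
  deriv (fun z => (tu um uS wR t z) ^ 3 - (uS z) ^ 3 - (tuR um wR t z) ^ 3) ζ
    - iteratedDeriv 2 (tuR um wR t) ζ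

/-- The squared `H^k(ℝ)` norm, `‖g‖²_{H^k} = Σ_{i=0}^{k} ∫ |∂^i g|²`. -/
def HnormSq (k : ℕ) (g : ℝ → ℝ) : ℝ :=
  ∑ i ∈ Finset.range (k + 1), ∫ ξ : ℝ, (iteratedDeriv i g ξ) ^ 2

/-- A perturbation solution `(φ, r)` on `[0,T]` with shift `X`: smooth, with
`φ(t,·), r(t,·) ∈ H²`, solving the shifted perturbation system, where `X` solves the
a-contraction shift ODE. -/
def PerturbSol (um τ T : ℝ) (uS : ℝ → ℝ) (wR φ r : ℝ → ℝ → ℝ) (X : ℝ → ℝ) : Prop :=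
  ContDiff ℝ (⊤ : ℕ∞) (fun p : ℝ × ℝ => φ p.1 p.2) ∧
  ContDiff ℝ (⊤ : ℕ∞) (fun p : ℝ × ℝ => r p.1 p.2) ∧
  (∀ t ∈ Set.Icc 0 T, ∀ i ≤ 2,
    Integrable (fun ξ : ℝ => (iteratedDeriv i (φ t) ξ) ^ 2) ∧
    Integrable (fun ξ : ℝ => (iteratedDeriv i (r t) ξ) ^ 2)) ∧
  X 0 = 0 ∧
  (∀ t : ℝ, HasDerivAt X ((32 / (25 * um ^ 2)) *
      ∫ ξ : ℝ, φ t ξ * W um (uS (ξ + X t)) * deriv uS (ξ + X t)) t) ∧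
  (∀ t ∈ Set.Icc 0 T, ∀ ξ : ℝ,
    deriv (fun s => φ s ξ) t - 3 * um ^ 2 * deriv (φ t) ξ
      + deriv (fun y => (φ t y + tu um uS wR t (y + X t)) ^ 3
          - (tu um uS wR t (y + X t)) ^ 3) ξ
      + deriv X t * (deriv uS (ξ + X t) + deriv (tuR um wR t) (ξ + X t))
      - deriv (r t) ξ
      = - Ferr um uS wR t (ξ + X t)) ∧
  (∀ t ∈ Set.Icc 0 T, ∀ ξ : ℝ,
    τ * deriv (fun s => r s ξ) t - τ * (3 * um ^ 2) * deriv (r t) ξ + r t ξ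
      - deriv (φ t) ξ
      + τ * deriv X t * deriv (tq um uS wR t) (ξ + X t)
      + τ * deriv (fun s => deriv (tuR um wR s) (ξ + X t)) t = 0)

/-- Shift of a time-dependent function by `-X(t)`: `g^{-X}(t,ξ) = g(t, ξ - X(t))`. -/
def shiftNeg (g : ℝ → ℝ → ℝ) (X : ℝ → ℝ) (t ξ : ℝ) : ℝ := g t (ξ - X t)

lemma cert_a1 (v : ℝ) (h1 : 0 ≤ v) (h2 : v ≤ (3/10)) :
    0 ≤ (4/5*(((v+2)*(1-v)^2)*(5/2*(1-v)*(4*v^3+1))))*((18+6*v-255*v^2+356*v^3)+(3*(1-v^2)*(5/2*(12*v^2-16*v^3-1))+3*v*(5/2*(1-v)*(4*v^3+1))-51/100*(5/2*(24*v-48*v^2))*((v+2)*(1-v)^2)-4/5)-(7/2-11*v))-(-47/10+18*v+3*v^2-85*v^3+89*v^4)^2 := by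
  have e : (4/5*(((v+2)*(1-v)^2)*(5/2*(1-v)*(4*v^3+1))))*((18+6*v-255*v^2+356*v^3)+(3*(1-v^2)*(5/2*(12*v^2-16*v^3-1))+3*v*(5/2*(1-v)*(4*v^3+1))-51/100*(5/2*(24*v-48*v^2))*((v+2)*(1-v)^2)-4/5)-(7/2-11*v))-(-47/10+18*v+3*v^2-85*v^3+89*v^4)^2 =
      (2710000000000/531441)*(v-0)^0*((3/10)-v)^12 +
      (6880000000000/177147)*(v-0)^1*((3/10)-v)^11 +
      (25216000000000/177147)*(v-0)^2*((3/10)-v)^10 +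
      (182434000000000/531441)*(v-0)^3*((3/10)-v)^9 +
      (35681860000000/59049)*(v-0)^4*((3/10)-v)^8 +
      (46499770000000/59049)*(v-0)^5*((3/10)-v)^7 +
      (133031063000000/177147)*(v-0)^6*((3/10)-v)^6 +
      (31096065760000/59049)*(v-0)^7*((3/10)-v)^5 +
      (16796777674000/59049)*(v-0)^8*((3/10)-v)^4 +
      (67868458110400/531441)*(v-0)^9*((3/10)-v)^3 +
      (8424648610240/177147)*(v-0)^10*((3/10)-v)^2 +
      (2176175041936/177147)*(v-0)^11*((3/10)-v)^1 +
      (3999941742272/2657205)*(v-0)^12*((3/10)-v)^0 := by ring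
  have x0 : 0 ≤ v - 0 := by linarith
  have z0 : 0 ≤ (3/10) - v := by linarith
  rw [e]; positivity

lemma cert_a2 (v : ℝ) (h1 : 0 ≤ v) (h2 : v ≤ (3/10)) :
    0 ≤ (7/2-11*v)*((3*(1-v^2)*(5/2*(12*v^2-16*v^3-1))+3*v*(5/2*(1-v)*(4*v^3+1))-51/100*(5/2*(24*v-48*v^2))*((v+2)*(1-v)^2)-4/5)+6*(5/2*(1-v)*(4*v^3+1))+10)-((3*(1-v^2)*(5/2*(12*v^2-16*v^3-1))+3*v*(5/2*(1-v)*(4*v^3+1))-51/100*(5/2*(24*v-48*v^2))*((v+2)*(1-v)^2)-4/5)+3*(5/2*(1-v)*(4*v^3+1)))^2 := by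
  have e : (7/2-11*v)*((3*(1-v^2)*(5/2*(12*v^2-16*v^3-1))+3*v*(5/2*(1-v)*(4*v^3+1))-51/100*(5/2*(24*v-48*v^2))*((v+2)*(1-v)^2)-4/5)+6*(5/2*(1-v)*(4*v^3+1))+10)-((3*(1-v^2)*(5/2*(12*v^2-16*v^3-1))+3*v*(5/2*(1-v)*(4*v^3+1))-51/100*(5/2*(24*v-48*v^2))*((v+2)*(1-v)^2)-4/5)+3*(5/2*(1-v)*(4*v^3+1)))^2 =
      (192700000000/19683)*(v-0)^0*((3/10)-v)^10 +
      (468310000000/6561)*(v-0)^1*((3/10)-v)^9 +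
      (131162000000/729)*(v-0)^2*((3/10)-v)^8 +
      (1270429600000/6561)*(v-0)^3*((3/10)-v)^7 +
      (190874180000/2187)*(v-0)^4*((3/10)-v)^6 +
      (16971772000/243)*(v-0)^5*((3/10)-v)^5 +
      (1065328525600/6561)*(v-0)^6*((3/10)-v)^4 +
      (122618748800/729)*(v-0)^7*((3/10)-v)^3 +
      (56844913468/729)*(v-0)^8*((3/10)-v)^2 +
      (1460401008152/98415)*(v-0)^9*((3/10)-v)^1 +
      (87740908924/164025)*(v-0)^10*((3/10)-v)^0 := by ring
  have x0 : 0 ≤ v - 0 := by linarith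
  have z0 : 0 ≤ (3/10) - v := by linarith
  rw [e]; positivity

lemma cert_b1 (v : ℝ) (h1 : (3/10) ≤ v) (h2 : v ≤ (1/2)) :
    0 ≤ (4/5*(((v+2)*(1-v)^2)*(5/2*(1-v)*(4*v^3+1))))*((18+6*v-255*v^2+356*v^3)+(3*(1-v^2)*(5/2*(12*v^2-16*v^3-1))+3*v*(5/2*(1-v)*(4*v^3+1))-51/100*(5/2*(24*v-48*v^2))*((v+2)*(1-v)^2)-4/5)-(58*(v-27/100)^2))-(-47/10+18*v+3*v^2-85*v^3+89*v^4)^2 := by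
  have e : (4/5*(((v+2)*(1-v)^2)*(5/2*(1-v)*(4*v^3+1))))*((18+6*v-255*v^2+356*v^3)+(3*(1-v^2)*(5/2*(12*v^2-16*v^3-1))+3*v*(5/2*(1-v)*(4*v^3+1))-51/100*(5/2*(24*v-48*v^2))*((v+2)*(1-v)^2)-4/5)-(58*(v-27/100)^2))-(-47/10+18*v+3*v^2-85*v^3+89*v^4)^2 =
      (165370728621/640)*(v-(3/10))^0*((1/2)-v)^12 +
      (298018793513/128)*(v-(3/10))^1*((1/2)-v)^11 +
      (1147727339195/128)*(v-(3/10))^2*((1/2)-v)^10 +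
      (2428038971975/128)*(v-(3/10))^3*((1/2)-v)^9 +
      (1485753781875/64)*(v-(3/10))^4*((1/2)-v)^8 +
      (968465089005/64)*(v-(3/10))^5*((1/2)-v)^7 +
      (209640182875/64)*(v-(3/10))^6*((1/2)-v)^6 +
      (23795260375/64)*(v-(3/10))^7*((1/2)-v)^5 +
      (619807673125/128)*(v-(3/10))^8*((1/2)-v)^4 +
      (876047278125/128)*(v-(3/10))^9*((1/2)-v)^3 +
      (539135609375/128)*(v-(3/10))^10*((1/2)-v)^2 +
      (164243046875/128)*(v-(3/10))^11*((1/2)-v)^1 +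
      (5083984375/32)*(v-(3/10))^12*((1/2)-v)^0 := by ring
  have x0 : 0 ≤ v - (3/10) := by linarith
  have z0 : 0 ≤ (1/2) - v := by linarith
  rw [e]; positivity

lemma cert_b2 (v : ℝ) (h1 : (3/10) ≤ v) (h2 : v ≤ (1/2)) :
    0 ≤ (58*(v-27/100)^2)*((3*(1-v^2)*(5/2*(12*v^2-16*v^3-1))+3*v*(5/2*(1-v)*(4*v^3+1))-51/100*(5/2*(24*v-48*v^2))*((v+2)*(1-v)^2)-4/5)+6*(5/2*(1-v)*(4*v^3+1))+10)-((3*(1-v^2)*(5/2*(12*v^2-16*v^3-1))+3*v*(5/2*(1-v)*(4*v^3+1))-51/100*(5/2*(24*v-48*v^2))*((v+2)*(1-v)^2)-4/5)+3*(5/2*(1-v)*(4*v^3+1)))^2 := by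
  have e : (58*(v-27/100)^2)*((3*(1-v^2)*(5/2*(12*v^2-16*v^3-1))+3*v*(5/2*(1-v)*(4*v^3+1))-51/100*(5/2*(24*v-48*v^2))*((v+2)*(1-v)^2)-4/5)+6*(5/2*(1-v)*(4*v^3+1))+10)-((3*(1-v^2)*(5/2*(12*v^2-16*v^3-1))+3*v*(5/2*(1-v)*(4*v^3+1))-51/100*(5/2*(24*v-48*v^2))*((v+2)*(1-v)^2)-4/5)+3*(5/2*(1-v)*(4*v^3+1)))^2 =
      (49262731529/1280)*(v-(3/10))^0*((1/2)-v)^11 +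
      (1039910783299/1280)*(v-(3/10))^1*((1/2)-v)^10 +
      (1240689743699/256)*(v-(3/10))^2*((1/2)-v)^9 +
      (3406041737145/256)*(v-(3/10))^3*((1/2)-v)^8 +
      (2377885106025/128)*(v-(3/10))^4*((1/2)-v)^7 +
      (1495145338995/128)*(v-(3/10))^5*((1/2)-v)^6 +
      (133163385795/128)*(v-(3/10))^6*((1/2)-v)^5 +
      (208835386425/128)*(v-(3/10))^7*((1/2)-v)^4 +
      (2216229251625/256)*(v-(3/10))^8*((1/2)-v)^3 +
      (2300894711875/256)*(v-(3/10))^9*((1/2)-v)^2 +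
      (997043984375/256)*(v-(3/10))^10*((1/2)-v)^1 +
      (163032453125/256)*(v-(3/10))^11*((1/2)-v)^0 := by ring
  have x0 : 0 ≤ v - (3/10) := by linarith
  have z0 : 0 ≤ (1/2) - v := by linarith
  rw [e]; positivity

noncomputable def PA (v : ℝ) : ℝ := (7/2) * (1-v)^2 * (v+2) / (1 - v - 7/4)
noncomputable def PA' (v : ℝ) : ℝ := (7/2)*(2*(1-v)-3)*(1-v)/(1-v-7/4) + (49/8)*(1-v)*(v+2)/(1-v-7/4)^2
noncomputable def PB (v : ℝ) : ℝ := -(2 * (1-v)^3 * (v+2)) / (v + 17/20)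
noncomputable def PB' (v : ℝ) : ℝ := (18*(1-v)^2-8*(1-v)^3)/(v+17/20) + (2 * (1-v)^3 * (v+2)) / (v + 17/20)^2
noncomputable def PC (v : ℝ) : ℝ := -47/10+18*v+3*v^2-85*v^3+89*v^4
noncomputable def PC' (v : ℝ) : ℝ := 18+6*v-255*v^2+356*v^3

lemma PA_deriv (v : ℝ) (hv : v ≤ -4/5) : HasDerivAt PA (PA' v) v := by
  have hne : (1 - v - 7/4) ≠ 0 := by linarith
  have h1 : HasDerivAt (fun v : ℝ => 1 - v) (-1) v := by
    simpa using (hasDerivAt_id v).const_sub 1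
  have h2 : HasDerivAt (fun v : ℝ => v + 2) 1 v := (hasDerivAt_id v).add_const 2
  have h3 : HasDerivAt (fun v : ℝ => 1 - v - 7/4) (-1) v := h1.sub_const _
  have := (((h1.pow 2).const_mul (7/2)).mul h2).div h3 hne
  refine (this.congr_deriv ?_)
  simp only [PA']
  simp
  field_simp
  ring

lemma PB_deriv (v : ℝ) (hv : -4/5 ≤ v) : HasDerivAt PB (PB' v) v := by
  have hne : (v + 17/20) ≠ 0 := by linarith
  have h1 : HasDerivAt (fun v : ℝ => 1 - v) (-1) v := by
    simpa using (hasDerivAt_id v).const_sub 1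
  have h2 : HasDerivAt (fun v : ℝ => v + 2) 1 v := (hasDerivAt_id v).add_const 2
  have h3 : HasDerivAt (fun v : ℝ => v + 17/20) 1 v := (hasDerivAt_id v).add_const _
  have := ((((h1.pow 3).const_mul 2).mul h2).neg).div h3 hne
  refine (this.congr_deriv ?_)
  simp only [PB']
  simp
  field_simp
  ring

lemma PC_deriv (v : ℝ) : HasDerivAt PC (PC' v) v := by
  have h1 := hasDerivAt_id v
  have := ((((h1.const_mul 18).const_add (-47/10)).add ((h1.pow 2).const_mul 3)).sub ((h1.pow 3).const_mul 85)).add ((h1.pow 4).const_mul 89)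
  refine (this.congr_deriv ?_)
  simp only [PC']
  simp
  ring

lemma sq_complete (A B p g : ℝ) (hA : 0 < A) :
    A*p^2 + 2*B*g*p + B^2/A*g^2 = A*(p + B/A*g)^2 := by
  field_simp
  ring

/-- the common left computation -/
lemma left_alg (s g k a A p P P' : ℝ) (hA : 0 < A) (ha : A ≤ a)
    (hP : (15/2*s+12/5) + P^2/A ≤ P') :
    0 ≤ a*p^2 + (-(15/2)*s-4/5)*(g+k)^2 + 15*k*s*(g+k) + (P'*g^2 + 2*P*g*p)
      - (15/2*s - 6/5)*k^2 := by
  have h1 : A*p^2 ≤ a*p^2 := mul_le_mul_of_nonneg_right ha (sq_nonneg p)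
  have h2 : ((15/2*s+12/5) + P^2/A)*g^2 ≤ P'*g^2 := mul_le_mul_of_nonneg_right hP (sq_nonneg g)
  have h3 : A*p^2 + 2*P*g*p + P^2/A*g^2 = A*(p + P/A*g)^2 := sq_complete A P p g hA
  have h4 : 0 ≤ A*(p + P/A*g)^2 := by positivity
  nlinarith [sq_nonneg (2*g - k)]

lemma lem1 (v p g k q : ℝ) (hv : -2 < v) (hv2 : v ≤ -4/5)
    (hq : (4/5)*((v+2)*(1-v)^2) ≤ q) :
    0 ≤ q*(5/2*(1-v))*p^2 + (3*(1-v^2)*(-5/2) + 3*v*(5/2*(1-v)) - 4/5)*(g+k)^2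
      + 6*k*(5/2*(1-v))*(g+k) + (PA' v*g^2 + 2*PA v*g*p) - (15/2*(1-v)-6/5)*k^2 := by
  have hs : 0 < 1 - v := by linarith
  have hx : 0 < v + 2 := by linarith
  have hc : 0 < 1 - v - 7/4 := by linarith
  have hA : 0 < 2*(1-v)^3*(v+2) := by positivity
  have ha : 2*(1-v)^3*(v+2) ≤ q*(5/2*(1-v)) := by nlinarith
  have key := left_alg (1-v) g k _ _ p (PA v) (PA' v) hA ha (by
    have e : PA' v - (PA v)^2/(2*(1-v)^3*(v+2)) = (7/2)*(2*(1-v)-3)*(1-v)/(1-v-7/4) := by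
      simp only [PA, PA']
      obtain ⟨d, hd⟩ : ∃ d, d = 1-v-7/4 := ⟨_, rfl⟩
      rw [← hd] at hc ⊢
      have hv' : v = -3/4 - d := by linarith
      field_simp
      rw [hv']
      ring
    have : 15/2*(1-v)+12/5 ≤ (7/2)*(2*(1-v)-3)*(1-v)/(1-v-7/4) := by
      rw [le_div_iff₀ hc]
      nlinarith
    linarith)
  linarith

lemma lem2 (v p g k q : ℝ) (hv : -4/5 ≤ v) (hv2 : v ≤ 0)
    (hq : (4/5)*((v+2)*(1-v)^2) ≤ q) :
    0 ≤ q*(5/2*(1-v))*p^2 + (3*(1-v^2)*(-5/2) + 3*v*(5/2*(1-v)) - 4/5)*(g+k)^2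
      + 6*k*(5/2*(1-v))*(g+k) + (PB' v*g^2 + 2*PB v*g*p) - (15/2*(1-v)-6/5)*k^2 := by
  have hs : 0 < 1 - v := by linarith
  have hx : 0 < v + 2 := by linarith
  have hc : 0 < v + 17/20 := by linarith
  have hA : 0 < 2*(1-v)^3*(v+2) := by positivity
  have ha : 2*(1-v)^3*(v+2) ≤ q*(5/2*(1-v)) := by nlinarith
  have key := left_alg (1-v) g k _ _ p (PB v) (PB' v) hA ha (by
    have e : PB' v - (PB v)^2/(2*(1-v)^3*(v+2)) = (18*(1-v)^2-8*(1-v)^3)/(v+17/20) := by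
      simp only [PB, PB']
      obtain ⟨d, hd⟩ : ∃ d, d = v+17/20 := ⟨_, rfl⟩
      rw [← hd] at hc ⊢
      have hv' : v = d - 17/20 := by linarith
      field_simp
      rw [hv']
      ring
    have : 15/2*(1-v)+12/5 ≤ (18*(1-v)^2-8*(1-v)^3)/(v+17/20) := by
      rw [le_div_iff₀ hc]
      nlinarith [mul_nonneg (by linarith : 0 ≤ v + 4/5) (by linarith : 0 ≤ -v), mul_nonneg (mul_nonneg (by linarith : 0 ≤ v + 4/5) (by linarith : 0 ≤ -v)) (by linarith : 0 ≤ -v)]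
    linarith)
  linarith

lemma mid_alg (a A p P P' V w E g k : ℝ) (hA : 0 < A) (ha : A ≤ a) (hE : 0 ≤ E)
    (h1 : 0 ≤ A*(P'+V-E) - P^2) (h2 : 0 ≤ E*(V+6*w+10) - (V+3*w)^2) (h3 : 0 < V + 6*w+10) :
    0 ≤ a*p^2 + V*(g+k)^2 + 6*k*w*(g+k) + (P'*g^2 + 2*P*g*p) + 10*k^2 := by
  have h4 : A*p^2 ≤ a*p^2 := mul_le_mul_of_nonneg_right ha (sq_nonneg p)
  have h5 : P^2/A ≤ P'+V-E := by rw [div_le_iff₀ hA]; linarith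
  have h6 : P^2/A*g^2 ≤ (P'+V-E)*g^2 := mul_le_mul_of_nonneg_right h5 (sq_nonneg g)
  have h7 : A*p^2 + 2*P*g*p + P^2/A*g^2 = A*(p + P/A*g)^2 := sq_complete A P p g hA
  have h8 : 0 ≤ A*(p + P/A*g)^2 := by positivity
  have h9 : (V+3*w)^2/(V+6*w+10) ≤ E := by rw [div_le_iff₀ h3]; linarith
  have h10 : (V+3*w)^2/(V+6*w+10)*g^2 ≤ E*g^2 := mul_le_mul_of_nonneg_right h9 (sq_nonneg g)
  have h11 : (V+3*w)^2/(V+6*w+10)*g^2 + 2*(V+3*w)*k*g + (V+6*w+10)*k^2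
    = (V+6*w+10)*(k + (V+3*w)/(V+6*w+10)*g)^2 := by
    rw [← sq_complete _ _ k g h3]; ring
  have h12 : 0 ≤ (V+6*w+10)*(k + (V+3*w)/(V+6*w+10)*g)^2 := by positivity
  nlinarith

lemma lem3 (v p g k q b : ℝ) (hv : 0 ≤ v) (hv2 : v ≤ 1/2)
    (hq : (4/5)*((v+2)*(1-v)^2) ≤ q) (hb : b ≤ 51/50*((v+2)*(1-v)^2)) :
    0 ≤ q*(5/2*(1-v)*(4*v^3+1))*p^2
      + (3*(1-v^2)*(5/2*(12*v^2-16*v^3-1)) + 3*v*(5/2*(1-v)*(4*v^3+1))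
        - (5/2*(24*v-48*v^2))/2*b - 4/5)*(g+k)^2
      + 6*k*(5/2*(1-v)*(4*v^3+1))*(g+k) + (PC' v*g^2 + 2*PC v*g*p) - (-10)*k^2 := by
  have hs : 0 < 1 - v := by linarith
  have hx : 0 < v + 2 := by linarith
  have hw : 0 < 5/2*(1-v)*(4*v^3+1) := by positivity
  have hA : 0 < 4/5*(((v+2)*(1-v)^2)*(5/2*(1-v)*(4*v^3+1))) := by positivity
  have ha : 4/5*(((v+2)*(1-v)^2)*(5/2*(1-v)*(4*v^3+1))) ≤ q*(5/2*(1-v)*(4*v^3+1)) := by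
    have := mul_le_mul_of_nonneg_right hq hw.le
    linarith
  have hw2 : 0 ≤ 5/2*(24*v-48*v^2) := by nlinarith
  have hbb : (5/2*(24*v-48*v^2))/2*b*(g+k)^2 ≤
      51/100*(5/2*(24*v-48*v^2))*((v+2)*(1-v)^2)*(g+k)^2 := by
    apply mul_le_mul_of_nonneg_right _ (sq_nonneg _)
    nlinarith [mul_le_mul_of_nonneg_left hb hw2]
  have hG : 0 < (3*(1-v^2)*(5/2*(12*v^2-16*v^3-1))+3*v*(5/2*(1-v)*(4*v^3+1))-51/100*(5/2*(24*v-48*v^2))*((v+2)*(1-v)^2)-4/5) + 6*(5/2*(1-v)*(4*v^3+1)) + 10 := by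
    have e : (3*(1-v^2)*(5/2*(12*v^2-16*v^3-1))+3*v*(5/2*(1-v)*(4*v^3+1))-51/100*(5/2*(24*v-48*v^2))*((v+2)*(1-v)^2)-4/5) + 6*(5/2*(1-v)*(4*v^3+1)) + 10 =
      (2672/5)*v^0*(1/2-v)^5 +
      (7864/5)*v^1*(1/2-v)^4 +
      (16904/5)*v^2*(1/2-v)^3 +
      (25376/5)*v^3*(1/2-v)^2 +
      (3326)*v^4*(1/2-v)^1 +
      (3722/5)*v^5*(1/2-v)^0 := by ring
    have z0 : 0 ≤ 1/2 - v := by linarith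
    have z1 : 0 < v^5 + (1/2-v)^5 := by
      rcases hv.lt_or_eq with h | h
      · positivity
      · rw [← h]; norm_num
    have z2 : (2672/5)*v^0*(1/2-v)^5 + (3722/5)*v^5*(1/2-v)^0 > 0 := by
      rcases hv.lt_or_eq with h | h
      · positivity
      · rw [← h]; norm_num
    rw [e]
    have z3 : 0 ≤ (7864/5)*v^1*(1/2-v)^4 + (16904/5)*v^2*(1/2-v)^3 + (25376/5)*v^3*(1/2-v)^2 + (3326)*v^4*(1/2-v)^1 := by positivity
    linarith
  rcases le_total v (3/10) with h | h
  · have := mid_alg _ _ p (PC v) (PC' v) _ _ (7/2-11*v) g k hA ha (by linarith)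
      (by simpa only [PC, PC'] using cert_a1 v hv h) (cert_a2 v hv h) hG
    linarith
  · have := mid_alg _ _ p (PC v) (PC' v) _ _ (58*(v-27/100)^2) g k hA ha (by positivity)
      (by simpa only [PC, PC'] using cert_b1 v h hv2) (cert_b2 v h hv2) hG
    linarith

lemma lem4 (v p g k q : ℝ) (hv : 1/2 ≤ v) (hv2 : v ≤ 1)
    (hq : (4/5)*((v+2)*(1-v)^2) ≤ q) :
    0 ≤ q*(15/8)*p^2 + (3*v*(15/8) - 4/5)*(g+k)^2
      + 6*k*(15/8)*(g+k) - (-16)*k^2 := by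
  have hq0 : 0 ≤ q := le_trans (by have : 0 ≤ v + 2 := by linarith
                                   positivity) hq
  have h1 : 0 ≤ q*(15/8)*p^2 := by positivity
  have h2 : 0 ≤ (3*v*(15/8) - 4/5 - 161/80)*(g+k)^2 := mul_nonneg (by linarith) (sq_nonneg _)
  nlinarith [sq_nonneg (161/80*(g+k) + 45/8*k), sq_nonneg k]

lemma piece {y yd f fd h : ℝ → ℝ} {P P' N N' : ℝ → ℝ} {k a b : ℝ} (hab : a ≤ b)
    (hy : ∀ ξ, HasDerivAt y (yd ξ) ξ) (hf : ∀ ξ, HasDerivAt f (fd ξ) ξ)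
    (hP : ∀ ξ ∈ Set.Icc a b, HasDerivAt P (P' (y ξ)) (y ξ))
    (hN : ∀ v, HasDerivAt N (N' v) v)
    (hIntg : Integrable h)
    (hle : ∀ ξ ∈ Set.Ioo a b, N' (y ξ) * yd ξ * k^2
      - (P' (y ξ) * yd ξ * (f ξ - k)^2 + P (y ξ) * (2 * (f ξ - k) * fd ξ)) ≤ h ξ) :
    (N (y b) * k^2 - P (y b) * (f b - k)^2) - (N (y a) * k^2 - P (y a) * (f a - k)^2)
      ≤ ∫ ξ in a..b, h ξ := by
  have hd : ∀ ξ ∈ Set.Icc a b, HasDerivAt (fun ξ => N (y ξ) * k^2 - P (y ξ) * (f ξ - k)^2)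
      (N' (y ξ) * yd ξ * k^2
      - (P' (y ξ) * yd ξ * (f ξ - k)^2 + P (y ξ) * (2 * (f ξ - k) * fd ξ))) ξ := by
    intro ξ hξ
    have h1 := ((hN (y ξ)).comp ξ (hy ξ)).mul_const (k^2)
    have h2 := (hP ξ hξ).comp ξ (hy ξ)
    have h3 := ((hf ξ).sub_const k).pow 2
    refine (h1.sub (h2.mul h3)).congr_deriv ?_
    simp
  exact intervalIntegral.sub_le_integral_of_hasDeriv_right_of_le hab
    (fun ξ hξ => (hd ξ hξ).continuousAt.continuousWithinAt)
    (fun ξ hξ => (hd ξ (Set.Ioo_subset_Icc_self hξ)).hasDerivWithinAt)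
    hIntg.integrableOn hle

lemma core {um γ : ℝ} {y yd f fd w V : ℝ → ℝ} (hum : 0 < um)
    (hy : ∀ ξ, HasDerivAt y (yd ξ) ξ) (hf : ∀ ξ, HasDerivAt f (fd ξ) ξ)
    (hpos : ∀ ξ, 0 < yd ξ) (hlo : ∀ ξ, -2 < y ξ) (hhi : ∀ ξ, y ξ < 1)
    (hyb : Tendsto y atBot (nhds (-2))) (hyt : Tendsto y atTop (nhds 1))
    (hfb : Tendsto f atBot (nhds 0)) (hft : Tendsto f atTop (nhds 0))
    (hq : ∀ ξ, (4/5)*((y ξ+2)*(1-y ξ)^2) ≤ γ * (yd ξ / um^2))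
    (hb : ∀ ξ, yd ξ / um^2 ≤ 51/50*((y ξ+2)*(1-y ξ)^2))
    (hw1 : ∀ ξ, y ξ < 0 → w ξ = 5/2*(1-y ξ))
    (hw2 : ∀ ξ, 0 < y ξ → y ξ < 1/2 → w ξ = 5/2*(1-y ξ)*(4*y ξ^3+1))
    (hw3 : ∀ ξ, 1/2 < y ξ → w ξ = 15/8)
    (hV1 : ∀ ξ, y ξ < 0 → V ξ = 3*(1-y ξ^2)*(-5/2) + 3*y ξ*(5/2*(1-y ξ)) - 4/5)
    (hV2 : ∀ ξ, 0 < y ξ → y ξ < 1/2 → V ξ = 3*(1-y ξ^2)*(5/2*(12*y ξ^2-16*y ξ^3-1))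
      + 3*y ξ*(5/2*(1-y ξ)*(4*y ξ^3+1)) - (5/2*(24*y ξ-48*y ξ^2))/2*(yd ξ / um^2) - 4/5)
    (hV3 : ∀ ξ, 1/2 < y ξ → V ξ = 3*y ξ*(15/8) - 4/5)
    (hi1 : Integrable (fun ξ => γ * w ξ * fd ξ^2 / um^2 + V ξ * f ξ^2 * yd ξ))
    (hi2 : Integrable (fun ξ => f ξ * w ξ * yd ξ)) :
    0 ≤ (∫ ξ, (γ * w ξ * fd ξ^2 / um^2 + V ξ * f ξ^2 * yd ξ))
      + 16/25 * (∫ ξ, f ξ * w ξ * yd ξ)^2 := by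
  have hycont : Continuous y := continuous_iff_continuousAt.2 fun ξ => (hy ξ).continuousAt
  have hmono : StrictMono y := strictMono_of_deriv_pos fun ξ => by rw [(hy ξ).deriv]; exact hpos ξ
  have ivt : ∀ c, -2 < c → c < 1 → ∃ ξ, y ξ = c := fun c h1 h2 => by
    obtain ⟨a, ha⟩ := (hyb.eventually (gt_mem_nhds h1)).exists
    obtain ⟨b, hb⟩ := (hyt.eventually (lt_mem_nhds h2)).exists
    exact mem_range_of_exists_le_of_exists_ge hycont ⟨a, ha.le⟩ ⟨b, hb.le⟩
  obtain ⟨x0, h0⟩ := ivt (-4/5) (by norm_num) (by norm_num)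
  obtain ⟨x1, h1⟩ := ivt 0 (by norm_num) (by norm_num)
  obtain ⟨x2, h2⟩ := ivt (1/2) (by norm_num) (by norm_num)
  have h01 : x0 ≤ x1 := (hmono.lt_iff_lt.1 (by rw [h0, h1]; norm_num)).le
  have h12 : x1 ≤ x2 := (hmono.lt_iff_lt.1 (by rw [h1, h2]; norm_num)).le
  obtain ⟨k, hk⟩ : ∃ k, k = f x0 := ⟨_, rfl⟩
  obtain ⟨h, hh⟩ : ∃ h : ℝ → ℝ, h = fun ξ => (γ * w ξ * fd ξ^2 / um^2 + V ξ * f ξ^2 * yd ξ)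
    + 6*k*(f ξ * w ξ * yd ξ) := ⟨_, rfl⟩
  have hIntg : Integrable h := by rw [hh]; exact hi1.add (hi2.const_mul _)
  -- pointwise rewriting
  have hpt : ∀ ξ n P P', 0 ≤ (γ * (yd ξ / um^2)) * w ξ * (fd ξ / yd ξ)^2
      + V ξ * ((f ξ - k) + k)^2 + 6*k*w ξ*((f ξ - k)+k)
      + (P' * (f ξ - k)^2 + 2*P*(f ξ - k)*(fd ξ / yd ξ)) - n*k^2 →
      n * yd ξ * k^2 - (P' * yd ξ * (f ξ - k)^2 + P * (2 * (f ξ - k) * fd ξ)) ≤ h ξ := by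
    intro ξ n P P' hle
    have hp := hpos ξ
    have := mul_nonneg hp.le hle
    have e : yd ξ * ((γ * (yd ξ / um^2)) * w ξ * (fd ξ / yd ξ)^2
      + V ξ * ((f ξ - k) + k)^2 + 6*k*w ξ*((f ξ - k)+k)
      + (P' * (f ξ - k)^2 + 2*P*(f ξ - k)*(fd ξ / yd ξ)) - n*k^2) = h ξ -
      (n * yd ξ * k^2 - (P' * yd ξ * (f ξ - k)^2 + P * (2 * (f ξ - k) * fd ξ))) := by
      rw [hh]
      field_simp
      ring
    linarith
  have N1 : ∀ v : ℝ, HasDerivAt (fun v : ℝ => 63/10*v - 15/4*v^2) (15/2*(1-v)-6/5) v := fun v => by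
    have h1 := hasDerivAt_id v
    refine ((h1.const_mul (63/10)).sub ((h1.pow 2).const_mul (15/4))).congr_deriv ?_
    simp; ring
  have N2 : ∀ v : ℝ, HasDerivAt (fun v : ℝ => (-10)*v) (-10) v := fun v => by
    simpa using (hasDerivAt_id v).const_mul (-10)
  have N3 : ∀ v : ℝ, HasDerivAt (fun v : ℝ => (-16)*v) (-16) v := fun v => by
    simpa using (hasDerivAt_id v).const_mul (-16)
  -- piece 1
  have p1 : ∀ a ≤ x0, (63/10*(-4/5) - 15/4*(-4/5)^2) * k^2 - ((63/10*y a - 15/4*y a^2) * k^2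
      - PA (y a) * (f a - k)^2) ≤ ∫ ξ in a..x0, h ξ := by
    intro a ha
    have := piece (P := PA) (P' := PA') (k := k) ha hy hf
      (fun ξ hξ => PA_deriv _ (by rw [← h0]; exact hmono.monotone hξ.2)) N1 hIntg
      (fun ξ hξ => by
        apply hpt
        have hlt : y ξ < -4/5 := by rw [← h0]; exact hmono hξ.2
        rw [hw1 ξ (by linarith), hV1 ξ (by linarith)]
        exact lem1 (y ξ) _ _ _ _ (hlo ξ) hlt.le (hq ξ))
    simp only [h0, ← hk, sub_self] at this
    linarith
  have p2 : (0 - PB 0 * (f x1 - k)^2) - (63/10*(-4/5) - 15/4*(-4/5)^2) * k^2 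
      ≤ ∫ ξ in x0..x1, h ξ := by
    have := piece (P := PB) (P' := PB') (k := k) h01 hy hf
      (fun ξ hξ => PB_deriv _ (by rw [← h0]; exact hmono.monotone hξ.1)) N1 hIntg
      (fun ξ hξ => by
        apply hpt
        have hlt : -4/5 < y ξ := by rw [← h0]; exact hmono hξ.1
        have hlt' : y ξ < 0 := by rw [← h1]; exact hmono hξ.2
        rw [hw1 ξ (by linarith), hV1 ξ (by linarith)]
        exact lem2 (y ξ) _ _ _ _ hlt.le hlt'.le (hq ξ))
    simp only [h0, h1, ← hk, sub_self] at this
    linarith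
  have p3 : (-5*k^2 - PC (1/2) * (f x2 - k)^2) - (0 - PC 0 * (f x1 - k)^2)
      ≤ ∫ ξ in x1..x2, h ξ := by
    have := piece (P := PC) (P' := PC') (k := k) h12 hy hf
      (fun ξ hξ => PC_deriv _) N2 hIntg
      (fun ξ hξ => by
        apply hpt
        have hlt : 0 < y ξ := by rw [← h1]; exact hmono hξ.1
        have hlt' : y ξ < 1/2 := by rw [← h2]; exact hmono hξ.2
        rw [hw2 ξ hlt hlt', hV2 ξ hlt hlt']
        exact lem3 (y ξ) _ _ _ _ _ hlt.le hlt'.le (hq ξ) (hb ξ))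
    simp only [h1, h2] at this
    linarith
  have p4 : ∀ b, x2 ≤ b → (-16)*y b * k^2 + 8*k^2 ≤ ∫ ξ in x2..b, h ξ := by
    intro b hb
    have := piece (P := fun _ => 0) (P' := fun _ => 0) (k := k) hb hy hf
      (fun ξ hξ => hasDerivAt_const _ _) N3 hIntg
      (fun ξ hξ => by
        apply hpt
        have hlt : 1/2 < y ξ := by rw [← h2]; exact hmono hξ.1
        rw [hw3 ξ hlt, hV3 ξ hlt]
        have := lem4 (y ξ) (fd ξ / yd ξ) (f ξ - k) k _ hlt.le (hhi ξ).le (hq ξ)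
        linarith)
    simp only [h2] at this
    linarith
  have hB0 : PB 0 ≤ PC 0 := by simp only [PB, PC]; norm_num
  have hC0 : PC (1/2) ≤ 0 := by simp only [PC]; norm_num
  have tot : ∀ᶠ R : ℝ in atTop, -5*k^2 + 8*k^2 + (-16)*y R * k^2
      - ((63/10*y (-R) - 15/4*y (-R)^2) * k^2 - PA (y (-R)) * (f (-R) - k)^2)
      ≤ ∫ ξ in (-R)..R, h ξ := by
    filter_upwards [eventually_ge_atTop (-x0), eventually_ge_atTop x2] with R hR1 hR2
    have q1 := p1 (-R) (by linarith)
    have q4 := p4 R hR2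
    have ii : ∀ a b, IntervalIntegrable h volume a b := fun a b => hIntg.intervalIntegrable
    rw [← intervalIntegral.integral_add_adjacent_intervals (ii (-R) x2) (ii x2 R),
      ← intervalIntegral.integral_add_adjacent_intervals (ii (-R) x1) (ii x1 x2),
      ← intervalIntegral.integral_add_adjacent_intervals (ii (-R) x0) (ii x0 x1)]
    have r1 := mul_le_mul_of_nonneg_right hB0 (sq_nonneg (f x1 - k))
    have r2 := mul_le_mul_of_nonneg_right hC0 (sq_nonneg (f x2 - k))
    linarith
  have hyb' := hyb.comp tendsto_neg_atTop_atBot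
  have hfb' := hfb.comp tendsto_neg_atTop_atBot
  have hPAc : Tendsto (fun R : ℝ => PA (y (-R))) atTop (nhds (PA (-2))) :=
    (PA_deriv (-2) (by norm_num)).continuousAt.tendsto.comp hyb'
  have lim1 : Tendsto (fun R : ℝ => -5*k^2 + 8*k^2 + (-16)*y R * k^2
      - ((63/10*y (-R) - 15/4*y (-R)^2) * k^2 - PA (y (-R)) * (f (-R) - k)^2)) atTop
      (nhds (-5*k^2 + 8*k^2 + (-16)*1 * k^2
      - ((63/10*(-2) - 15/4*(-2)^2) * k^2 - PA (-2) * (0 - k)^2))) := by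
    refine Tendsto.sub ((tendsto_const_nhds).add ((hyt.const_mul _).mul_const _)) (Tendsto.sub ?_ ?_)
    · exact ((hyb'.const_mul _).sub ((hyb'.pow 2).const_mul _)).mul_const _
    · exact hPAc.mul ((hfb'.sub_const k).pow 2)
  have lim2 := intervalIntegral_tendsto_integral hIntg tendsto_neg_atTop_atBot tendsto_id
  have fin := le_of_tendsto_of_tendsto lim1 lim2 tot
  have hPA2 : PA (-2) = 0 := by simp [PA]
  have hsum : ∫ ξ, h ξ = (∫ ξ, (γ * w ξ * fd ξ^2 / um^2 + V ξ * f ξ^2 * yd ξ))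
      + 6*k*(∫ ξ, f ξ * w ξ * yd ξ) := by
    rw [hh, integral_add hi1 (hi2.const_mul _), integral_const_mul]
  rw [hPA2, hsum] at fin
  nlinarith [sq_nonneg (15/4*k - 4/5*(∫ ξ, f ξ * w ξ * yd ξ)), sq_nonneg k]

lemma W_left {um u : ℝ} (hu : u < 0) :
    W um u = 5/2*um*(um-u) ∧ deriv (W um) u = -(5/2*um) ∧ deriv (deriv (W um)) u = 0 := by
  have e1 : ∀ v < 0, W um v = 5/2*um*(um-v) := fun v hv => by simp [W, hv]
  have d1 : ∀ v < 0, deriv (W um) v = -(5/2*um) := fun v hv => by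
    have : W um =ᶠ[nhds v] fun v => 5/2*um*(um-v) := by
      filter_upwards [gt_mem_nhds hv] with x hx using e1 x hx
    rw [this.deriv_eq]
    have := ((hasDerivAt_id v).const_sub um).const_mul (5/2*um)
    simpa using this.deriv
  refine ⟨e1 u hu, d1 u hu, ?_⟩
  have : deriv (W um) =ᶠ[nhds u] fun _ => -(5/2*um) := by
    filter_upwards [gt_mem_nhds hu] with x hx using d1 x hx
  rw [this.deriv_eq]; simp

lemma W_right {um u : ℝ} (hum : 0 < um) (hu : um/2 < u) :
    W um u = 15/8*um^2 ∧ deriv (W um) u = 0 ∧ deriv (deriv (W um)) u = 0 := by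
  have e1 : ∀ v > um/2, W um v = 15/8*um^2 := fun v hv => by
    have h1 : ¬ v < 0 := by linarith
    have h2 : ¬ v < um/2 := by linarith
    simp [W, h1, h2]
  have d1 : ∀ v > um/2, deriv (W um) v = 0 := fun v hv => by
    have : W um =ᶠ[nhds v] fun v => 15/8*um^2 := by
      filter_upwards [lt_mem_nhds hv] with x hx using e1 x hx
    rw [this.deriv_eq]; simp
  refine ⟨e1 u hu, d1 u hu, ?_⟩
  have : deriv (W um) =ᶠ[nhds u] fun _ => 0 := by
    filter_upwards [lt_mem_nhds hu] with x hx using d1 x hx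
  rw [this.deriv_eq]; simp

lemma W_mid {um u : ℝ} (hu0 : 0 < u) (hu : u < um/2) :
    W um u = 5/(2*um^2)*(um-u)*(4*u^3+um^3) ∧
    deriv (W um) u = 5/(2*um^2)*(12*um*u^2-16*u^3-um^3) ∧
    deriv (deriv (W um)) u = 5/(2*um^2)*(24*um*u-48*u^2) := by
  have e1 : ∀ v, 0 < v → v < um/2 → W um v = 5/(2*um^2)*(um-v)*(4*v^3+um^3) := fun v hv hv2 => by
    have h1 : ¬ v < 0 := by linarith
    simp [W, h1, hv2]
  have d1 : ∀ v, 0 < v → v < um/2 → deriv (W um) v = 5/(2*um^2)*(12*um*v^2-16*v^3-um^3) :=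
    fun v hv hv2 => by
    have : W um =ᶠ[nhds v] fun v => 5/(2*um^2)*(um-v)*(4*v^3+um^3) := by
      filter_upwards [lt_mem_nhds hv, gt_mem_nhds hv2] with x hx hx2 using e1 x hx hx2
    rw [this.deriv_eq]
    have h1 := hasDerivAt_id v
    have := ((h1.const_sub um).const_mul (5/(2*um^2))).mul
      (((h1.pow 3).const_mul 4).add_const (um^3))
    refine this.deriv.trans ?_
    simp
    ring
  refine ⟨e1 u hu0 hu, d1 u hu0 hu, ?_⟩
  have : deriv (W um) =ᶠ[nhds u] fun v => 5/(2*um^2)*(12*um*v^2-16*v^3-um^3) := by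
    filter_upwards [lt_mem_nhds hu0, gt_mem_nhds hu] with x hx hx2 using d1 x hx hx2
  rw [this.deriv_eq]
  have h1 := hasDerivAt_id u
  have := (((((h1.pow 2).const_mul (12*um)).sub ((h1.pow 3).const_mul 16)).sub_const (um^3)).const_mul
    (5/(2*um^2)))
  refine this.deriv.trans ?_
  simp
  left
  ring

lemma W_bdd (um : ℝ) (hum : 0 < um) : ∃ C, ∀ u, -2*um < u → u < um →
    |W um u| ≤ C ∧ |deriv (W um) u| ≤ C ∧ |deriv (deriv (W um)) u| ≤ C := by
  refine ⟨(10*um^2 + 200*um + 200) + (|W um 0| + |deriv (W um) 0| + |deriv (deriv (W um)) 0|)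
    + (|W um (um/2)| + |deriv (W um) (um/2)| + |deriv (deriv (W um)) (um/2)|), ?_⟩
  intro u h1 h2
  have a1 := abs_nonneg (W um 0)
  have a2 := abs_nonneg (deriv (W um) 0)
  have a3 := abs_nonneg (deriv (deriv (W um)) 0)
  have b1 := abs_nonneg (W um (um/2))
  have b2 := abs_nonneg (deriv (W um) (um/2))
  have b3 := abs_nonneg (deriv (deriv (W um)) (um/2))
  have c1 : 0 < um^2 := by positivity
  suffices H : u ≠ 0 → u ≠ um/2 → |W um u| ≤ 10*um^2 ∧ |deriv (W um) u| ≤ 200*um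
      ∧ |deriv (deriv (W um)) u| ≤ 200 by
    by_cases e0 : u = 0
    · rw [e0]; refine ⟨?_, ?_, ?_⟩ <;> linarith
    by_cases e1 : u = um/2
    · rw [e1]; refine ⟨?_, ?_, ?_⟩ <;> linarith
    obtain ⟨q1, q2, q3⟩ := H e0 e1
    refine ⟨?_, ?_, ?_⟩ <;> linarith
  intro e0 e1
  rcases lt_or_gt_of_ne e0 with h | h
  · obtain ⟨q1, q2, q3⟩ := W_left (um := um) h
    rw [q1, q2, q3]
    refine ⟨?_, ?_, by norm_num⟩
    · rw [abs_le]; constructor <;> nlinarith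
    · rw [abs_le]; constructor <;> nlinarith
  rcases lt_or_gt_of_ne e1 with h' | h'
  · obtain ⟨q1, q2, q3⟩ := W_mid h h'
    obtain ⟨v, rfl⟩ : ∃ v, u = um*v := ⟨u/um, by field_simp⟩
    have v0 : 0 < v := by nlinarith
    have v1 : v < 1/2 := by nlinarith
    have s2 : v^2 ≤ 1/4 := by nlinarith
    have s3 : v^3 ≤ 1/8 := by nlinarith [sq_nonneg v]
    have s30 : 0 < v^3 := by positivity
    have s20 : 0 < v^2 := by positivity
    have s4 : v^4 ≤ 1/8 := by nlinarith
    have s40 : 0 < v^4 := by positivity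
    have r1 : 5/(2*um^2)*(um-um*v)*(4*(um*v)^3+um^3) = um^2*(5/2*(4*v^3+1-4*v^4-v)) := by
      field_simp; ring
    have r2 : 5/(2*um^2)*(12*um*(um*v)^2-16*(um*v)^3-um^3) = um*(5/2*(12*v^2-16*v^3-1)) := by
      field_simp
    have r3 : 5/(2*um^2)*(24*um*(um*v)-48*(um*v)^2) = 5/2*(24*v-48*v^2) := by
      field_simp
    rw [q1, q2, q3, r1, r2, r3, abs_mul (um^2) _, abs_mul um _, abs_of_pos hum, abs_of_pos c1]
    refine ⟨?_, ?_, ?_⟩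
    · rw [mul_comm]; apply mul_le_mul_of_nonneg_right _ c1.le
      rw [abs_le]; constructor <;> linarith
    · rw [mul_comm]; apply mul_le_mul_of_nonneg_right _ hum.le
      rw [abs_le]; constructor <;> linarith
    · rw [abs_le]; constructor <;> linarith
  · obtain ⟨q1, q2, q3⟩ := W_right hum h'
    rw [q1, q2, q3, abs_of_pos (by positivity)]
    refine ⟨?_, ?_, ?_⟩
    · linarith
    · simp; linarith
    · simp

lemma W_deriv_nonpos (um u : ℝ) (hum : 0 < um) (h0 : u ≠ 0) (h1 : u ≠ um/2) :
    deriv (W um) u ≤ 0 := by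
  rcases lt_or_gt_of_ne h0 with h | h
  · rw [(W_left (um := um) h).2.1]; linarith
  rcases lt_or_gt_of_ne h1 with h' | h'
  · rw [(W_mid h h').2.1]
    apply mul_nonpos_of_nonneg_of_nonpos (by positivity)
    have : 12*um*u^2-16*u^3-um^3 = -(um-2*u)^2*(4*u+um) := by ring
    rw [this]
    have : 0 ≤ (um-2*u)^2*(4*u+um) := by positivity
    linarith
  · rw [(W_right hum h').2.1]

lemma W_meas (um : ℝ) : Measurable (W um) := by
  unfold W
  refine Measurable.ite measurableSet_Iio (by fun_prop) (Measurable.ite measurableSet_Iio (by fun_prop) (by fun_prop))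

lemma tends_zero {f fd : ℝ → ℝ} (hf : ∀ ξ, HasDerivAt f (fd ξ) ξ) (hc : Continuous fd)
    (h0 : Integrable (fun ξ => f ξ ^ 2)) (h1 : Integrable (fun ξ => fd ξ ^ 2)) :
    Tendsto f atBot (nhds 0) ∧ Tendsto f atTop (nhds 0) := by
  have hfc : Continuous f := continuous_iff_continuousAt.2 fun x => (hf x).continuousAt
  have hd : ∀ ξ, HasDerivAt (fun ξ => f ξ ^ 2) (2 * f ξ * fd ξ) ξ := fun ξ => by
    have := (hf ξ).fun_pow 2
    simpa using this
  have hi : Integrable (fun ξ => 2 * f ξ * fd ξ) := by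
    refine (h0.add h1).mono' (by fun_prop) (ae_of_all _ fun ξ => ?_)
    simp only [Real.norm_eq_abs, Pi.add_apply]
    rw [abs_le]
    constructor <;> nlinarith [sq_nonneg (f ξ - fd ξ), sq_nonneg (f ξ + fd ξ)]
  have key : ∀ l : Filter ℝ, Tendsto (fun ξ => f ξ ^ 2) l (nhds 0) → Tendsto f l (nhds 0) := by
    intro l h
    have := (Real.continuous_sqrt.tendsto 0).comp h
    rw [Real.sqrt_zero] at this
    refine (tendsto_zero_iff_abs_tendsto_zero _).2 (this.congr fun ξ => ?_)
    simp [Real.sqrt_sq_eq_abs]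
  constructor
  · exact key _ (tendsto_zero_of_hasDerivAt_of_integrableOn_Iic (a := 0) (fun x _ => hd x)
      hi.integrableOn h0.integrableOn)
  · exact key _ (tendsto_zero_of_hasDerivAt_of_integrableOn_Ioi (a := 0) (fun x _ => hd x)
      hi.integrableOn h0.integrableOn)

lemma deriv_integrable {u : ℝ → ℝ} {a b : ℝ} (hu : ContDiff ℝ (⊤ : ℕ∞) u)
    (hpos : ∀ ξ, 0 < deriv u ξ) (ha : Tendsto u atBot (nhds a)) (hb : Tendsto u atTop (nhds b)) :
    Integrable (deriv u) := by
  have hd : Differentiable ℝ u := hu.differentiable (by simp)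
  have hc : Continuous (deriv u) := hu.continuous_deriv (by simp)
  refine integrable_of_intervalIntegral_norm_tendsto (l := atTop) (a := fun n : ℝ => -n)
    (b := fun n : ℝ => n) (b - a) (fun i => ?_) tendsto_neg_atTop_atBot tendsto_id ?_
  · exact (hc.integrableOn_Icc).mono_set Set.Ioc_subset_Icc_self
  · refine (hb.sub (ha.comp tendsto_neg_atTop_atBot)).congr fun n => ?_
    have : (fun x => ‖deriv u x‖) = deriv u := by
      ext x; rw [Real.norm_eq_abs, abs_of_pos (hpos x)]
    rw [this, intervalIntegral.integral_deriv_eq_sub (fun x _ => hd x)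
      (hc.intervalIntegrable _ _)]
    rfl

/-- lower bound for the shock part `G^S(t)` of the relative-entropy
production, under smallness of the shock strength. -/
theorem stmt_12 :
    ∃ δ₀ > (0:ℝ),
      ∀ (um τ uplus T : ℝ) (uS : ℝ → ℝ) (wR φ r : ℝ → ℝ → ℝ) (X : ℝ → ℝ),
        0 < um → 0 < τ →
        τ ≤ min (1 / (63 * (3 * um ^ 2) * (-2 * um) ^ 2)) (8 / 7785) →
        um < uplus → uplus - um = (3 * um) ^ 2 →
        3 * um ≤ δ₀ → 0 ≤ T →
        IsShockProfile um τ uS →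
        BurgersSol (3 * uplus ^ 2) (3 * um ^ 2) wR →
        PerturbSol um τ T uS wR φ r X →
        ∀ t ∈ Set.Icc 0 T,
          deriv X t * (∫ ξ : ℝ, shiftNeg φ X t ξ * W um (uS ξ) * deriv uS ξ)
            + (∫ ξ : ℝ, (shiftNeg r X t ξ) ^ 2 * W um (uS ξ))
            - (3 / 4) * (∫ ξ : ℝ, (shiftNeg φ X t ξ) ^ 4 * deriv (W um) (uS ξ) * deriv uS ξ)
            + (∫ ξ : ℝ, (shiftNeg φ X t ξ) ^ 2 * deriv uS ξ *
                (3 * um ^ 2 * deriv (W um) (uS ξ) - 3 * (uS ξ) ^ 2 * deriv (W um) (uS ξ)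
                  + 3 * uS ξ * W um (uS ξ)
                  - deriv (deriv (W um)) (uS ξ) / 2 * deriv uS ξ))
          ≥ (∫ ξ : ℝ, (shiftNeg r X t ξ) ^ 2 * W um (uS ξ))
            - (5 / 6 + 9 * τ * (3 * um ^ 2) * um ^ 2 / 8) *
                (∫ ξ : ℝ, (deriv (shiftNeg φ X t) ξ) ^ 2 * W um (uS ξ))
            + (4 / 5) * um ^ 3 * (∫ ξ : ℝ, (shiftNeg φ X t ξ) ^ 2 * deriv uS ξ)
            + (25 / 64) * um ^ 2 * |deriv X t| ^ 2
            + (3 / 4) * (∫ ξ : ℝ, (shiftNeg φ X t ξ) ^ 4 * |deriv (W um) (uS ξ)| *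
                deriv uS ξ) := by
  refine ⟨1, one_pos, ?_⟩
  intro um τ uplus T uS wR φ r X hum hτ hτle _ _ _ _ hS _ hP t ht
  obtain ⟨hSs, hSb, hSd, hSl, hSr⟩ := hS
  obtain ⟨hφ, -, hPi, -, hX, -, -⟩ := hP
  have hτ1 := hτle.trans (min_le_left _ _)
  have hκ : 756 * (τ * um ^ 4) ≤ 1 := by
    rw [le_div_iff₀ (by positivity)] at hτ1
    nlinarith
  have hκ0 : 0 < τ * um ^ 4 := by positivity
  have hum2 : 0 < um ^ 2 := by positivity
  -- normalized profile
  have hylo : ∀ ξ, -2 < uS ξ / um := fun ξ => by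
    rw [lt_div_iff₀ hum]; exact (hSb ξ).1
  have hyhi : ∀ ξ, uS ξ / um < 1 := fun ξ => by
    rw [div_lt_iff₀ hum]; linarith [(hSb ξ).2]
  have huy : ∀ ξ, uS ξ = um * (uS ξ / um) := fun ξ => by field_simp
  have hDlo : ∀ ξ, 83/84 ≤ 1 + 9 * (τ * um ^ 4) * ((uS ξ / um) ^ 2 - 1) := fun ξ => by
    nlinarith [sq_nonneg (uS ξ / um)]
  have hDhi : ∀ ξ, 1 + 9 * (τ * um ^ 4) * ((uS ξ / um) ^ 2 - 1) ≤ 1 + 27 * (τ * um ^ 4) :=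
    fun ξ => by
    have : (uS ξ / um) ^ 2 ≤ 4 := by nlinarith [hylo ξ, hyhi ξ]
    nlinarith
  have hyd : ∀ ξ, (deriv uS ξ / um / um ^ 2) * (1 + 9 * (τ * um ^ 4) * ((uS ξ / um) ^ 2 - 1))
      = (uS ξ / um + 2) * (1 - uS ξ / um) ^ 2 := fun ξ => by
    have hD := hDlo ξ
    have e : 1 + 3 * τ * (3 * um ^ 2) * ((uS ξ) ^ 2 - um ^ 2)
        = 1 + 9 * (τ * um ^ 4) * ((uS ξ / um) ^ 2 - 1) := by
      field_simp; ring
    rw [hSd ξ, e]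
    have hD0 : 1 + 9 * (τ * um ^ 4) * ((uS ξ / um) ^ 2 - 1) ≠ 0 := by linarith
    have e2 : (uS ξ - -2 * um) * (uS ξ - um) ^ 2
        = um ^ 3 * ((uS ξ / um + 2) * (1 - uS ξ / um) ^ 2) := by
      field_simp; ring
    rw [e2]
    generalize 1 + 9 * (τ * um ^ 4) * ((uS ξ / um) ^ 2 - 1) = D at hD0
    field_simp
  have hq0 : ∀ ξ, 0 < (uS ξ / um + 2) * (1 - uS ξ / um) ^ 2 := fun ξ => by
    have h1 : 0 < uS ξ / um + 2 := by linarith [hylo ξ]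
    have h2 : 0 < 1 - uS ξ / um := by linarith [hyhi ξ]
    positivity
  have hz0 : ∀ ξ, 0 < deriv uS ξ / um / um ^ 2 := fun ξ => by
    have h1 := hyd ξ
    have h2 := hq0 ξ
    rw [← h1] at h2
    exact (pos_iff_pos_of_mul_pos h2).2 (by linarith [hDlo ξ])
  have hup : ∀ ξ, 0 < deriv uS ξ := fun ξ => by
    have := mul_pos (mul_pos (hz0 ξ) hum2) hum
    have e : deriv uS ξ / um / um ^ 2 * um ^ 2 * um = deriv uS ξ := by field_simp
    rwa [e] at this
  have hSdiff : Differentiable ℝ uS := hSs.differentiable (by simp)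
  have hSc : Continuous uS := hSdiff.continuous
  have hSdc : Continuous (deriv uS) := hSs.continuous_deriv (by simp)
  have hmono : StrictMono uS := strictMono_of_deriv_pos hup
  have hSI : Integrable (deriv uS) := deriv_integrable hSs hup hSl hSr
  have hbb : ∀ ξ, deriv uS ξ / um / um ^ 2
      ≤ 51/50 * ((uS ξ / um + 2) * (1 - uS ξ / um) ^ 2) := fun ξ => by
    have h1 := hyd ξ
    have h2 := hDlo ξ
    have h3 := hz0 ξ
    rw [← h1]
    nlinarith
  have hubd : ∀ ξ, |deriv uS ξ| ≤ um ^ 3 * 100 := fun ξ => by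
    rw [abs_of_pos (hup ξ)]
    have h1 := hbb ξ
    have h2 : (uS ξ / um + 2) * (1 - uS ξ / um) ^ 2 ≤ 27 := by
      have a1 := hylo ξ
      have a2 := hyhi ξ
      have : (1 - uS ξ / um) ^ 2 ≤ 9 := by nlinarith
      nlinarith [sq_nonneg (1 - uS ξ / um)]
    have e : deriv uS ξ = um ^ 3 * (deriv uS ξ / um / um ^ 2) := by field_simp
    rw [e]
    apply mul_le_mul_of_nonneg_left _ (by positivity)
    linarith
  -- the perturbation
  have hφt : ContDiff ℝ (⊤ : ℕ∞) (φ t) :=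
    hφ.comp (contDiff_const.prodMk contDiff_id)
  have hfs : ContDiff ℝ (⊤ : ℕ∞) (shiftNeg φ X t) :=
    hφt.comp (contDiff_id.sub contDiff_const)
  have hXd := (hX t).deriv
  have hXI : (∫ ξ : ℝ, φ t ξ * W um (uS (ξ + X t)) * deriv uS (ξ + X t))
      = ∫ ξ : ℝ, shiftNeg φ X t ξ * W um (uS ξ) * deriv uS ξ := by
    rw [← integral_add_right_eq_self
      (fun ξ : ℝ => shiftNeg φ X t ξ * W um (uS ξ) * deriv uS ξ) (X t)]
    simp [shiftNeg]
  have hf0 : Integrable (fun ξ => shiftNeg φ X t ξ ^ 2) := by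
    have := ((hPi t ht 0 (by norm_num)).1).comp_sub_right (X t)
    simpa [shiftNeg] using this
  have hfd1 : ∀ ξ, deriv (shiftNeg φ X t) ξ = deriv (φ t) (ξ - X t) := fun ξ => by
    have : shiftNeg φ X t = fun ξ => φ t (ξ - X t) := rfl
    rw [this, deriv_comp_sub_const]
  have hf1 : Integrable (fun ξ => deriv (shiftNeg φ X t) ξ ^ 2) := by
    have := ((hPi t ht 1 (by norm_num)).1).comp_sub_right (X t)
    simpa [hfd1, iteratedDeriv_one] using this
  rw [hXI] at hXd
  generalize shiftNeg φ X t = f at *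
  generalize deriv X t = Xd at *
  have hfdiff : Differentiable ℝ f := hfs.differentiable (by simp)
  have hfdc : Continuous (deriv f) := hfs.continuous_deriv (by simp)
  have hfc : Continuous f := hfdiff.continuous
  obtain ⟨hfb, hft⟩ := tends_zero (fun ξ => (hfdiff ξ).hasDerivAt) hfdc hf0 hf1
  -- boundedness of the weights
  obtain ⟨C, hC⟩ := W_bdd um hum
  have hW0 : AEStronglyMeasurable (fun ξ => W um (uS ξ)) volume :=
    ((W_meas um).comp hSc.measurable).aestronglyMeasurable
  have hW1 : AEStronglyMeasurable (fun ξ => deriv (W um) (uS ξ)) volume :=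
    ((measurable_deriv (W um)).comp hSc.measurable).aestronglyMeasurable
  have hW2 : AEStronglyMeasurable (fun ξ => deriv (deriv (W um)) (uS ξ)) volume :=
    ((measurable_deriv (deriv (W um))).comp hSc.measurable).aestronglyMeasurable
  have hCW := fun ξ => hC (uS ξ) (hSb ξ).1 (hSb ξ).2
  have hC0 : 0 ≤ C := (abs_nonneg _).trans (hCW 0).1
  have hub : ∀ ξ, |uS ξ| ≤ 2 * um := fun ξ => by
    rw [abs_le]; constructor <;> linarith [(hSb ξ).1, (hSb ξ).2]
  have iA : Integrable (fun ξ => deriv f ξ ^ 2 * W um (uS ξ)) :=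
    hf1.mul_bdd hW0 (ae_of_all _ fun ξ => (hCW ξ).1)
  have iC : Integrable (fun ξ => f ξ ^ 2 * deriv uS ξ) :=
    hf0.mul_bdd hSdc.aestronglyMeasurable (ae_of_all _ fun ξ => hubd ξ)
  have iB : Integrable (fun ξ => f ξ ^ 2 * deriv uS ξ *
                (3 * um ^ 2 * deriv (W um) (uS ξ) - 3 * (uS ξ) ^ 2 * deriv (W um) (uS ξ)
                  + 3 * uS ξ * W um (uS ξ)
                  - deriv (deriv (W um)) (uS ξ) / 2 * deriv uS ξ)) := by
    have i1 : Integrable (fun ξ => f ξ ^ 2 * deriv uS ξ * deriv (W um) (uS ξ)) :=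
      iC.mul_bdd hW1 (ae_of_all _ fun ξ => (hCW ξ).2.1)
    have i2 : Integrable (fun ξ => f ξ ^ 2 * deriv uS ξ * deriv (W um) (uS ξ) * uS ξ) :=
      i1.mul_bdd hSc.aestronglyMeasurable (ae_of_all _ fun ξ => hub ξ)
    have i3 : Integrable (fun ξ => f ξ ^ 2 * deriv uS ξ * deriv (W um) (uS ξ) * uS ξ * uS ξ) :=
      i2.mul_bdd hSc.aestronglyMeasurable (ae_of_all _ fun ξ => hub ξ)
    have i4 : Integrable (fun ξ => f ξ ^ 2 * deriv uS ξ * W um (uS ξ)) :=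
      iC.mul_bdd hW0 (ae_of_all _ fun ξ => (hCW ξ).1)
    have i5 : Integrable (fun ξ => f ξ ^ 2 * deriv uS ξ * W um (uS ξ) * uS ξ) :=
      i4.mul_bdd hSc.aestronglyMeasurable (ae_of_all _ fun ξ => hub ξ)
    have i6 : Integrable (fun ξ => f ξ ^ 2 * deriv uS ξ * deriv (deriv (W um)) (uS ξ)) :=
      iC.mul_bdd hW2 (ae_of_all _ fun ξ => (hCW ξ).2.2)
    have i7 : Integrable (fun ξ => f ξ ^ 2 * deriv uS ξ * deriv (deriv (W um)) (uS ξ)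
        * deriv uS ξ) :=
      i6.mul_bdd hSdc.aestronglyMeasurable (ae_of_all _ fun ξ => hubd ξ)
    refine ((((i1.const_mul (3 * um ^ 2)).sub (i3.const_mul 3)).add (i5.const_mul 3)).sub
      (i7.const_mul (1/2))).congr (ae_of_all _ fun ξ => ?_)
    simp only [Pi.add_apply, Pi.sub_apply]
    ring
  have iI : Integrable (fun ξ => f ξ * W um (uS ξ) * deriv uS ξ) := by
    have i0 : Integrable (fun ξ => f ξ * deriv uS ξ) := by
      refine (iC.add hSI).mono' (by fun_prop) (ae_of_all _ fun ξ => ?_)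
      simp only [Real.norm_eq_abs, Pi.add_apply]
      rw [abs_mul, abs_of_pos (hup ξ)]
      have h1 : |f ξ| ≤ f ξ ^ 2 + 1 := by
        rw [← sq_abs (f ξ)]; nlinarith [sq_nonneg (|f ξ| - 1), abs_nonneg (f ξ)]
      nlinarith [hup ξ]
    refine (i0.mul_bdd hW0 (ae_of_all _ fun ξ => (hCW ξ).1)).congr (ae_of_all _ fun ξ => ?_)
    show f ξ * deriv uS ξ * W um (uS ξ) = _
    ring
  -- quartic term
  have hnull : ∀ c : ℝ, ∀ᵐ ξ : ℝ, uS ξ ≠ c := fun c => by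
    have hs : {ξ | uS ξ = c}.Subsingleton := fun a ha b hb =>
      hmono.injective (ha.trans hb.symm)
    rw [ae_iff]
    simpa using hs.measure_zero volume
  have hQ : (∫ ξ : ℝ, f ξ ^ 4 * |deriv (W um) (uS ξ)| * deriv uS ξ)
      = -(∫ ξ : ℝ, f ξ ^ 4 * deriv (W um) (uS ξ) * deriv uS ξ) := by
    rw [← integral_neg]
    apply integral_congr_ae
    filter_upwards [hnull 0, hnull (um/2)] with ξ h1 h2
    rw [abs_of_nonpos (W_deriv_nonpos um (uS ξ) hum h1 h2)]
    ring
  have hyD : ∀ ξ, HasDerivAt (fun ξ => uS ξ / um) (deriv uS ξ / um) ξ := fun ξ =>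
    (hSdiff ξ).hasDerivAt.div_const um
  set γ : ℝ := 5 / 6 + 9 * τ * (3 * um ^ 2) * um ^ 2 / 8 with hγ
  have e1 : ∀ ξ, γ * (W um (uS ξ) / um ^ 2) * deriv f ξ ^ 2 / um ^ 2
      + ((3 * um ^ 2 * deriv (W um) (uS ξ) - 3 * (uS ξ) ^ 2 * deriv (W um) (uS ξ)
                  + 3 * uS ξ * W um (uS ξ)
                  - deriv (deriv (W um)) (uS ξ) / 2 * deriv uS ξ) / um ^ 3 - 4 / 5)
        * f ξ ^ 2 * (deriv uS ξ / um)
      = (γ / um ^ 4 * (deriv f ξ ^ 2 * W um (uS ξ)) + 1 / um ^ 4 * (f ξ ^ 2 * deriv uS ξ *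
                (3 * um ^ 2 * deriv (W um) (uS ξ) - 3 * (uS ξ) ^ 2 * deriv (W um) (uS ξ)
                  + 3 * uS ξ * W um (uS ξ)
                  - deriv (deriv (W um)) (uS ξ) / 2 * deriv uS ξ)))
        - 4 / 5 / um * (f ξ ^ 2 * deriv uS ξ) := fun ξ => by
    clear_value γ
    field_simp
    ring
  have e2 : ∀ ξ, f ξ * (W um (uS ξ) / um ^ 2) * (deriv uS ξ / um)
      = 1 / um ^ 3 * (f ξ * W um (uS ξ) * deriv uS ξ) := fun ξ => by
    field_simp
  have key := core (um := um) (γ := γ) (y := fun ξ => uS ξ / um) (yd := fun ξ => deriv uS ξ / um)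
    (f := f) (fd := deriv f) (w := fun ξ => W um (uS ξ) / um ^ 2)
    (V := fun ξ => (3 * um ^ 2 * deriv (W um) (uS ξ) - 3 * (uS ξ) ^ 2 * deriv (W um) (uS ξ)
                  + 3 * uS ξ * W um (uS ξ)
                  - deriv (deriv (W um)) (uS ξ) / 2 * deriv uS ξ) / um ^ 3 - 4 / 5)
    hum hyD (fun ξ => (hfdiff ξ).hasDerivAt) (fun ξ => div_pos (hup ξ) hum) hylo hyhi
    (by have := hSl.div_const um
        rwa [mul_div_assoc, div_self hum.ne', mul_one] at this)
    (by have := hSr.div_const um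
        rwa [div_self hum.ne'] at this)
    hfb hft
    (fun ξ => by
      show 4 / 5 * ((uS ξ / um + 2) * (1 - uS ξ / um) ^ 2) ≤ γ * (deriv uS ξ / um / um ^ 2)
      rw [← hyd ξ]
      have h1 := hDhi ξ
      have h2 := hz0 ξ
      have h3 : 4 / 5 * (1 + 9 * (τ * um ^ 4) * ((uS ξ / um) ^ 2 - 1)) ≤ γ := by
        rw [hγ]; nlinarith
      nlinarith)
    hbb
    (fun ξ h => by
      have hu : uS ξ < 0 := by
        rw [huy ξ]; exact mul_neg_of_pos_of_neg hum h
      show W um (uS ξ) / um ^ 2 = 5/2*(1 - uS ξ / um)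
      rw [(W_left hu).1]; field_simp)
    (fun ξ h h' => by
      have hu : 0 < uS ξ := by rw [huy ξ]; exact mul_pos hum h
      have hu' : uS ξ < um / 2 := by
        have := (div_lt_iff₀ hum).1 h'
        linarith
      show W um (uS ξ) / um ^ 2 = 5/2*(1 - uS ξ / um) * (4 * (uS ξ / um) ^ 3 + 1)
      rw [(W_mid hu hu').1]; field_simp)
    (fun ξ h => by
      have hu' : um / 2 < uS ξ := by
        have := (lt_div_iff₀ hum).1 h
        linarith
      show W um (uS ξ) / um ^ 2 = 15/8
      rw [(W_right hum hu').1]; field_simp)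
    (fun ξ h => by
      have hu : uS ξ < 0 := by
        rw [huy ξ]; exact mul_neg_of_pos_of_neg hum h
      obtain ⟨q1, q2, q3⟩ := W_left (um := um) hu
      simp only [q1, q2, q3]
      field_simp
      ring)
    (fun ξ h h' => by
      have hu : 0 < uS ξ := by rw [huy ξ]; exact mul_pos hum h
      have hu' : uS ξ < um / 2 := by
        have := (div_lt_iff₀ hum).1 h'
        linarith
      obtain ⟨q1, q2, q3⟩ := W_mid hu hu'
      simp only [q1, q2, q3]
      field_simp)
    (fun ξ h => by
      have hu' : um / 2 < uS ξ := by
        have := (lt_div_iff₀ hum).1 h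
        linarith
      obtain ⟨q1, q2, q3⟩ := W_right hum hu'
      simp only [q1, q2, q3]
      field_simp
      ring)
    (by
      refine (((iA.const_mul (γ / um ^ 4)).add (iB.const_mul (1 / um ^ 4))).sub
        (iC.const_mul (4 / 5 / um))).congr (ae_of_all _ fun ξ => ?_)
      exact (e1 ξ).symm)
    (by
      refine (iI.const_mul (1 / um ^ 3)).congr (ae_of_all _ fun ξ => ?_)
      exact (e2 ξ).symm)
  simp only [e1, e2] at key
  have iAB := (iA.const_mul (γ / um ^ 4)).add (iB.const_mul (1 / um ^ 4))
  simp only [Pi.add_def] at iAB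
  rw [integral_sub iAB (iC.const_mul (4 / 5 / um)),
    integral_add (iA.const_mul (γ / um ^ 4)) (iB.const_mul (1 / um ^ 4)),
    integral_const_mul, integral_const_mul, integral_const_mul, integral_const_mul] at key
  rw [hQ, sq_abs, hXd]
  generalize (∫ ξ : ℝ, f ξ * W um (uS ξ) * deriv uS ξ) = I at *
  generalize (∫ ξ : ℝ, deriv f ξ ^ 2 * W um (uS ξ)) = Ja at *
  generalize (∫ ξ : ℝ, f ξ ^ 2 * deriv uS ξ) = Jc at *
  generalize (∫ ξ : ℝ, f ξ ^ 2 * deriv uS ξ *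
                (3 * um ^ 2 * deriv (W um) (uS ξ) - 3 * (uS ξ) ^ 2 * deriv (W um) (uS ξ)
                  + 3 * uS ξ * W um (uS ξ)
                  - deriv (deriv (W um)) (uS ξ) / 2 * deriv uS ξ)) = Jb at *
  have k2 := mul_nonneg (by positivity : 0 ≤ um ^ 4) key
  have k3 : um ^ 4 * (γ / um ^ 4 * Ja + 1 / um ^ 4 * Jb - 4 / 5 / um * Jc
      + 16 / 25 * (1 / um ^ 3 * I) ^ 2)
      = γ * Ja + Jb - 4 / 5 * um ^ 3 * Jc + 16 / 25 * (I ^ 2 / um ^ 2) := by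
    clear_value γ
    field_simp
  rw [k3] at k2
  have k4 : 32 / (25 * um ^ 2) * I * I = 32 / 25 * (I ^ 2 / um ^ 2) := by field_simp
  have k5 : 25 / 64 * um ^ 2 * (32 / (25 * um ^ 2) * I) ^ 2 = 16 / 25 * (I ^ 2 / um ^ 2) := by
    field_simp; ring
  rw [k4, k5]
  linarith
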